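/- arXiv:math/0102116 — 4 statements merged into one kernel-verified Lean document; each statement's English description precedes it below -/
import Mathlib

section
/- Let ρ be a compatible sl₂(ℂ)-representation on A and ρ_ε a compatible infinitesimal deformation with L_ε = L + εv. Let j ≥ 1 and α ∈ P^{n−2j}. Then in A[ε] one has the identity L^j(α) = L_ε^{j+1}(ε(N−n+j+1)Q_v²(α)) + L_ε^j(α − ε((N−n+2j+1)L(Q_v²(α)) + jQ_v¹(α))) − L_ε^{j−1}(εjQ_v⁰(α)), and each of the three elements ε(N−n+j+1)Q_v²(α), α − ε((N−n+2j+1)L(Q_v²(α)) + jQ_v¹(α)), and εjQ_v⁰(α) is ρ_ε-primitive; i.e., this is the primitive decomposition of L^j(α) with respect to ρ_ε. -/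
/-- A compatible `sl₂(ℂ)`-representation on a graded algebra `A = ⊕ₙ Aⁿ` (graded pieces
`𝒜 n`, indexed by `ℤ`): the generators `L`, `Λ`, `B` satisfy the `sl₂` commutation
relations, `L` and `Λ` are homogeneous of degree `2` and `-2`, `B` acts on `Aⁿ` as
multiplication by `N - n`, and `L(αβ) = L(α)β`. -/
structure CompatSL2 (N : ℕ) (A : Type) [Ring A] [Algebra ℂ A]
    (𝒜 : ℤ → Submodule ℂ A) : Type where
  L : Module.End ℂ A
  Lam : Module.End ℂ A
  B : Module.End ℂ A
  comm_LamL : Lam * L - L * Lam = B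
  comm_BL : B * L - L * B = (-2 : ℂ) • L
  comm_BLam : B * Lam - Lam * B = (2 : ℂ) • Lam
  L_deg : ∀ (n : ℤ), ∀ x ∈ 𝒜 n, L x ∈ 𝒜 (n + 2)
  Lam_deg : ∀ (n : ℤ), ∀ x ∈ 𝒜 n, Lam x ∈ 𝒜 (n - 2)
  B_weight : ∀ (n : ℤ), ∀ x ∈ 𝒜 n, B x = ((N : ℤ) - n) • x
  L_mul : ∀ a b : A, L (a * b) = L a * b

/-- The endomorphism `f + ε g` of `A[ε] = A ⊗ ℂ[ε]/(ε²)`, identified with `A × A` via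
`a + ε b ↔ (a, b)`; it sends `a + εb` to `f a + ε (f b + g a)`. -/
def deform {A : Type} [Ring A] [Algebra ℂ A] (f g : Module.End ℂ A) :
    Module.End ℂ (A × A) :=
  f.prodMap f + (LinearMap.inr ℂ A A) ∘ₗ g ∘ₗ (LinearMap.fst ℂ A A)

/-- The deformed Lefschetz operator `L_ε = L + ε v`, where `v` acts by (right)
multiplication. -/
def Leps {A : Type} [Ring A] [Algebra ℂ A] (L : Module.End ℂ A) (v : A) :
    Module.End ℂ (A × A) :=
  deform L (LinearMap.mulRight ℂ v)

/-- The deformed dual Lefschetz operator `Λ_ε = Λ + ε [Λ, φ]`. -/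
def Lameps {A : Type} [Ring A] [Algebra ℂ A] (Lam φ : Module.End ℂ A) :
    Module.End ℂ (A × A) :=
  deform Lam (Lam * φ - φ * Lam)

namespace CompatSL2

variable {N : ℕ} {A : Type} [Ring A] [Algebra ℂ A] {𝒜 : ℤ → Submodule ℂ A}

lemma L_pow_succ_apply (S : CompatSL2 N A 𝒜) (k : ℕ) (x : A) :
    (S.L ^ (k + 1)) x = S.L ((S.L ^ k) x) := by
  rw [pow_succ', Module.End.mul_apply]

lemma L_pow_mem (S : CompatSL2 N A 𝒜) {d : ℤ} {x : A} (hx : x ∈ 𝒜 d) (k : ℕ) :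
    (S.L ^ k) x ∈ 𝒜 (d + 2 * k) := by
  induction k with
  | zero => simpa using hx
  | succ k ih =>
    rw [pow_succ', Module.End.mul_apply]
    convert S.L_deg _ _ ih using 2
    push_cast
    ring

lemma Lam_pow_mem (S : CompatSL2 N A 𝒜) {d : ℤ} {x : A} (hx : x ∈ 𝒜 d) (k : ℕ) :
    (S.Lam ^ k) x ∈ 𝒜 (d - 2 * k) := by
  induction k with
  | zero => simpa using hx
  | succ k ih =>
    rw [pow_succ', Module.End.mul_apply]
    convert S.Lam_deg _ _ ih using 2
    push_cast
    ring

lemma B_apply (S : CompatSL2 N A 𝒜) {d : ℤ} {x : A} (hx : x ∈ 𝒜 d) :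
    S.B x = ((N : ℂ) - d) • x := by
  rw [S.B_weight d x hx, ← Int.cast_smul_eq_zsmul ℂ]
  push_cast
  rfl

lemma Lam_L_apply (S : CompatSL2 N A 𝒜) {d : ℤ} {x : A} (hx : x ∈ 𝒜 d) :
    S.Lam (S.L x) = S.L (S.Lam x) + ((N : ℂ) - d) • x := by
  rw [← S.B_apply hx, ← S.comm_LamL]
  simp

lemma Lam_L_pow_succ_apply (S : CompatSL2 N A 𝒜) {d : ℤ} {x : A} (hx : x ∈ 𝒜 d) (k : ℕ) :
    S.Lam ((S.L ^ (k + 1)) x) =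
      (S.L ^ (k + 1)) (S.Lam x) + (((k : ℂ) + 1) * ((N : ℂ) - d - k)) • (S.L ^ k) x := by
  induction k with
  | zero => simpa using S.Lam_L_apply hx
  | succ k ih =>
    rw [S.L_pow_succ_apply (k + 1), S.L_pow_succ_apply (k + 1),
      S.Lam_L_apply (S.L_pow_mem hx (k + 1)), ih, map_add, map_smul, ← S.L_pow_succ_apply k]
    push_cast
    module

lemma exists_L_pow_eq_zero (S : CompatSL2 N A 𝒜)
    (hbound : ∀ n : ℤ, (n < 0 ∨ 2 * (N : ℤ) < n) → 𝒜 n = ⊥)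
    {d : ℤ} {x : A} (hx : x ∈ 𝒜 d) (k : ℕ) : ∃ r, (S.L ^ (k + r)) x = 0 := by
  refine ⟨2 * N + d.natAbs + 1, ?_⟩
  have h := S.L_pow_mem hx (k + (2 * N + d.natAbs + 1))
  rwa [hbound _ (Or.inr (by omega)), Submodule.mem_bot] at h

lemma exists_Lam_pow_eq_zero (S : CompatSL2 N A 𝒜)
    (hbound : ∀ n : ℤ, (n < 0 ∨ 2 * (N : ℤ) < n) → 𝒜 n = ⊥)
    {d : ℤ} {x : A} (hx : x ∈ 𝒜 d) : ∃ r, (S.Lam ^ r) x = 0 := by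
  refine ⟨d.natAbs + 1, ?_⟩
  have h := S.Lam_pow_mem hx (d.natAbs + 1)
  rwa [hbound _ (Or.inl (by omega)), Submodule.mem_bot] at h

lemma L_pow_eq_zero_of_L_pow_succ_eq_zero (S : CompatSL2 N A 𝒜) {d : ℤ} {x : A}
    (hx : x ∈ 𝒜 d) (hp : S.Lam x = 0) {k : ℕ} (hk : (N : ℤ) - d ≠ k)
    (h : (S.L ^ (k + 1)) x = 0) : (S.L ^ k) x = 0 := by
  have h1 := S.Lam_L_pow_succ_apply hx k
  rw [h, hp, map_zero, map_zero, zero_add] at h1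
  refine (smul_eq_zero.mp h1.symm).resolve_left (mul_ne_zero (Nat.cast_add_one_ne_zero k) ?_)
  intro h2
  apply hk
  exact_mod_cast sub_eq_zero.mp h2

/-- A primitive vector of weight `N - d` is annihilated by all powers `L ^ k` with `k > N - d`. -/
lemma L_pow_eq_zero_of_primitive (S : CompatSL2 N A 𝒜)
    (hbound : ∀ n : ℤ, (n < 0 ∨ 2 * (N : ℤ) < n) → 𝒜 n = ⊥)
    {d : ℤ} {x : A} (hx : x ∈ 𝒜 d) (hp : S.Lam x = 0) {k : ℕ} (hk : (N : ℤ) - d < k) :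
    (S.L ^ k) x = 0 := by
  obtain ⟨r, hr⟩ := S.exists_L_pow_eq_zero hbound hx k
  induction r with
  | zero => exact hr
  | succ r ih =>
    exact ih (S.L_pow_eq_zero_of_L_pow_succ_eq_zero hx hp (by push_cast; omega) hr)

lemma eq_zero_of_primitive_of_L_pow_eq_zero (S : CompatSL2 N A 𝒜)
    {d : ℤ} {x : A} (hx : x ∈ 𝒜 d) (hp : S.Lam x = 0) {k : ℕ} (hk : (k : ℤ) ≤ N - d)
    (h : (S.L ^ k) x = 0) : x = 0 := by
  induction k with
  | zero => simpa using h
  | succ k ih =>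
    push_cast at hk
    exact ih (by omega) (S.L_pow_eq_zero_of_L_pow_succ_eq_zero hx hp (by omega) h)

/-- Hard Lefschetz: `L ^ k` is injective on the weight space of weight `k`. -/
lemma eq_zero_of_L_pow_eq_zero (S : CompatSL2 N A 𝒜)
    (hbound : ∀ n : ℤ, (n < 0 ∨ 2 * (N : ℤ) < n) → 𝒜 n = ⊥)
    {d : ℤ} {x : A} (hx : x ∈ 𝒜 d) {k : ℕ} (hk : (k : ℤ) = N - d)
    (h : (S.L ^ k) x = 0) : x = 0 := by
  obtain ⟨r, hr⟩ := S.exists_Lam_pow_eq_zero hbound hx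
  induction r generalizing d x k with
  | zero => simpa using hr
  | succ r ih =>
    refine S.eq_zero_of_primitive_of_L_pow_eq_zero hx ?_ hk.le h
    refine ih (S.Lam_deg d x hx) (k := k + 2) (by push_cast; omega) ?_ (by simpa [pow_succ] using hr)
    have h1 := S.Lam_L_pow_succ_apply hx k
    rw [S.L_pow_succ_apply k x, h, map_zero, map_zero, smul_zero, add_zero] at h1
    rw [S.L_pow_succ_apply, ← h1, map_zero]

lemma L_pow_mul (S : CompatSL2 N A 𝒜) (k : ℕ) (a b : A) :
    (S.L ^ k) (a * b) = (S.L ^ k) a * b := by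
  induction k with
  | zero => simp
  | succ k ih => simp [pow_succ', ih, S.L_mul]

lemma Leps_pow_succ_apply (S : CompatSL2 N A 𝒜) (v a b : A) (k : ℕ) :
    (Leps S.L v ^ (k + 1)) (a, b) =
      ((S.L ^ (k + 1)) a, (S.L ^ (k + 1)) b + ((k : ℂ) + 1) • (S.L ^ k) (a * v)) := by
  induction k with
  | zero => simp [Leps, deform]
  | succ k ih =>
    rw [pow_succ', Module.End.mul_apply, ih]
    simp only [Leps, deform, LinearMap.add_apply, LinearMap.prodMap_apply, LinearMap.comp_apply,
      LinearMap.fst_apply, LinearMap.inr_apply, LinearMap.mulRight_apply, Prod.mk_add_mk, add_zero,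
      map_add, map_smul, ← S.L_pow_succ_apply, S.L_pow_mul, S.L_mul, Prod.mk.injEq,
      true_and]
    push_cast
    module

lemma Leps_pow_inr (S : CompatSL2 N A 𝒜) (v b : A) (k : ℕ) :
    (Leps S.L v ^ k) (0, b) = (0, (S.L ^ k) b) := by
  cases k with
  | zero => simp
  | succ k => simp [S.Leps_pow_succ_apply]

lemma L_pow_succ_comm (S : CompatSL2 N A 𝒜) {φ : Module.End ℂ A} {v : A}
    (hφL : S.L * φ - φ * S.L = LinearMap.mulRight ℂ v) (x : A) (k : ℕ) :
    (S.L ^ (k + 1)) (φ x) = φ ((S.L ^ (k + 1)) x) + ((k : ℂ) + 1) • (S.L ^ k) (x * v) := by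
  have h (y : A) : S.L (φ y) = φ (S.L y) + y * v := by
    rw [← sub_eq_iff_eq_add']
    exact LinearMap.congr_fun hφL y
  induction k with
  | zero => simpa using h x
  | succ k ih =>
    rw [S.L_pow_succ_apply, ih, map_add, h, map_smul, ← S.L_pow_mul, ← S.L_pow_succ_apply,
      ← S.L_pow_succ_apply]
    push_cast
    module

/-- The infinitesimal variation of `Λ` on a primitive vector is determined by the component `q2`
of the primitive decomposition of its product with `v`. -/
lemma Lam_deformation_primitive (S : CompatSL2 N A 𝒜)
    (hbound : ∀ n : ℤ, (n < 0 ∨ 2 * (N : ℤ) < n) → 𝒜 n = ⊥)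
    {φ : Module.End ℂ A} {v : A} (hφ0 : ∀ (n : ℤ), ∀ x ∈ 𝒜 n, φ x ∈ 𝒜 n)
    (hφL : S.L * φ - φ * S.L = LinearMap.mulRight ℂ v)
    {d : ℤ} {α q0 q1 q2 : A} (hα : α ∈ 𝒜 d) (hαp : S.Lam α = 0)
    (hq0 : q0 ∈ 𝒜 (d + 2)) (hq1 : q1 ∈ 𝒜 d) (hq2 : q2 ∈ 𝒜 (d - 2))
    (hq0p : S.Lam q0 = 0) (hq1p : S.Lam q1 = 0) (hq2p : S.Lam q2 = 0)
    (hqdec : α * v = q0 + S.L q1 + (S.L ^ 2) q2) :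
    S.Lam (φ α) = (((N : ℂ) - d + 1) * ((N : ℂ) - d + 2)) • q2 := by
  rcases lt_or_ge ((N : ℤ) - d) 0 with hneg | hnonneg
  · have hα0 : α = 0 := by
      simpa using S.L_pow_eq_zero_of_primitive hbound hα hαp (k := 0) (by simpa using hneg)
    rw [hα0, map_zero, map_zero]
    symm
    by_cases h1 : (N : ℤ) - d + 1 = 0
    · rw [show (N : ℂ) - d + 1 = 0 by exact_mod_cast h1, zero_mul, zero_smul]
    by_cases h2 : (N : ℤ) - d + 2 = 0
    · rw [show (N : ℂ) - d + 2 = 0 by exact_mod_cast h2, mul_zero, zero_smul]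
    have : q2 = 0 := by
      simpa using S.L_pow_eq_zero_of_primitive hbound hq2 hq2p (k := 0) (by push_cast; omega)
    rw [this, smul_zero]
  · obtain ⟨m, hm⟩ := Int.eq_ofNat_of_zero_le hnonneg
    have hmC : (N : ℂ) - d = m := by exact_mod_cast hm
    have hx : φ α ∈ 𝒜 d := hφ0 d α hα
    have hLφ : (S.L ^ (m + 1)) (φ α) = ((m : ℂ) + 1) • (S.L ^ (m + 2)) q2 := by
      rw [S.L_pow_succ_comm hφL, S.L_pow_eq_zero_of_primitive hbound hα hαp (by push_cast; omega),
        map_zero, zero_add, hqdec, map_add, map_add,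
        S.L_pow_eq_zero_of_primitive hbound hq0 hq0p (by omega), ← Module.End.mul_apply,
        ← pow_succ, S.L_pow_eq_zero_of_primitive hbound hq1 hq1p (by push_cast; omega), zero_add,
        zero_add, ← Module.End.mul_apply, ← pow_add]
    have hLφ' : (S.L ^ (m + 2)) (φ α) = 0 := by
      rw [S.L_pow_succ_apply, hLφ, map_smul, ← S.L_pow_succ_apply,
        S.L_pow_eq_zero_of_primitive hbound hq2 hq2p (by push_cast; omega), smul_zero]
    have hLLam := S.Lam_L_pow_succ_apply hx (m + 1)
    rw [hLφ', map_zero, hLφ, hmC] at hLLam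
    rw [hmC, ← sub_eq_zero]
    refine S.eq_zero_of_L_pow_eq_zero hbound (k := m + 2)
      (sub_mem (S.Lam_deg d _ hx) (Submodule.smul_mem _ _ hq2)) (by push_cast; omega) ?_
    rw [map_sub, map_smul, eq_neg_of_add_eq_zero_left hLLam.symm]
    push_cast
    module

end CompatSL2

/-- **Proposition (Huybrechts, Prop. 1.6).** For a compatible deformation with
`L_ε = L + εv` and `α ∈ P^{n-2j}` (`j ≥ 1`), the primitive decomposition of `Lʲ(α)`
with respect to `ρ_ε` is
`Lʲ(α) = L_ε^{j+1}(ε(N−n+j+1)Q²_v(α)) + L_ε^j(α − ε((N−n+2j+1)L Q²_v(α) + j Q¹_v(α)))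
  − L_ε^{j-1}(ε j Q⁰_v(α))`,
each of the three arguments being `ρ_ε`-primitive.  Here `A[ε]` is modelled as `A × A`
with `a + εb ↔ (a, b)`. -/
theorem primitive_decomposition_of_Lj_deformed
    (N : ℕ) (A : Type) [Ring A] [Algebra ℂ A] [FiniteDimensional ℂ A]
    (𝒜 : ℤ → Submodule ℂ A) [GradedAlgebra 𝒜]
    (hbound : ∀ n : ℤ, (n < 0 ∨ 2 * (N : ℤ) < n) → 𝒜 n = ⊥)
    (hgc : ∀ (p q : ℤ), ∀ x ∈ 𝒜 p, ∀ y ∈ 𝒜 q, x * y = ((-1 : ℂ) ^ (p * q)) • (y * x))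
    (S : CompatSL2 N A 𝒜)
    (φ : Module.End ℂ A) (v : A) (hv : v ∈ 𝒜 2)
    (hφ0 : ∀ (n : ℤ), ∀ x ∈ 𝒜 n, φ x ∈ 𝒜 n)
    (hφL : S.L * φ - φ * S.L = LinearMap.mulRight ℂ v)
    (n : ℤ) (j : ℕ) (hj : 1 ≤ j)
    (α : A) (hαm : α ∈ 𝒜 (n - 2 * (j : ℤ))) (hαp : S.Lam α = 0)
    (q0 q1 q2 : A)
    (hq0 : q0 ∈ 𝒜 (n - 2 * (j : ℤ) + 2)) (hq1 : q1 ∈ 𝒜 (n - 2 * (j : ℤ))) (hq2 : q2 ∈ 𝒜 (n - 2 * (j : ℤ) - 2))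
    (hq0p : S.Lam q0 = 0) (hq1p : S.Lam q1 = 0) (hq2p : S.Lam q2 = 0)
    (hqdec : α * v = q0 + S.L q1 + (S.L ^ 2) q2)
    :
    ((S.L ^ j) α, (0 : A)) =
        (Leps S.L v ^ (j + 1)) ((0 : A), ((N : ℂ) - (n : ℂ) + (j : ℂ) + 1) • q2)
        + (Leps S.L v ^ j)
            (α, -(((N : ℂ) - (n : ℂ) + 2 * (j : ℂ) + 1) • S.L q2 + (j : ℂ) • q1))
        - (Leps S.L v ^ (j - 1)) ((0 : A), (j : ℂ) • q0)
      ∧ Lameps S.Lam φ ((0 : A), ((N : ℂ) - (n : ℂ) + (j : ℂ) + 1) • q2) = 0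
      ∧ Lameps S.Lam φ
          (α, -(((N : ℂ) - (n : ℂ) + 2 * (j : ℂ) + 1) • S.L q2 + (j : ℂ) • q1)) = 0
      ∧ Lameps S.Lam φ ((0 : A), (j : ℂ) • q0) = 0 := by
  obtain ⟨i, rfl⟩ : ∃ i, j = i + 1 := ⟨j - 1, by omega⟩
  have hinr (x : A) (hx : S.Lam x = 0) (c : ℂ) : Lameps S.Lam φ (0, c • x) = 0 := by
    simp [Lameps, deform, hx]
  refine ⟨?_, hinr q2 hq2p _, ?_, hinr q0 hq0p _⟩
  · rw [S.Leps_pow_inr, S.Leps_pow_inr, S.Leps_pow_succ_apply, hqdec, Nat.add_sub_cancel]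
    simp only [Prod.mk_add_mk, Prod.mk_sub_mk, zero_add, sub_zero, Prod.mk.injEq, true_and,
      map_neg, map_add, map_smul, ← Module.End.mul_apply, ← pow_succ, ← pow_add]
    push_cast
    module
  · have hΛφ := S.Lam_deformation_primitive hbound hφ0 hφL hαm hαp hq0 hq1 hq2 hq0p hq1p hq2p hqdec
    simp only [Lameps, deform, LinearMap.add_apply, LinearMap.prodMap_apply, LinearMap.comp_apply,
      LinearMap.fst_apply, LinearMap.inr_apply, LinearMap.sub_apply, Module.End.mul_apply, hαp,
      map_zero, hΛφ, map_neg, map_add, map_smul, S.Lam_L_apply hq2, hq1p, hq2p, Prod.mk_add_mk,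
      Prod.mk_eq_zero, add_zero, true_and]
    push_cast
    module
end

section
/- Let ρ be a compatible sl₂(ℂ)-representation on A and ρ_ε a compatible infinitesimal deformation with L_ε = L + εv, and assume moreover that v ∈ P² is primitive. Then for every j ≥ 1 the primitive decomposition of L^j(1) with respect to ρ_ε is L^j(1) = L_ε^j(1) + L_ε^{j−1}(−jεv); in particular 1 and −jεv are ρ_ε-primitive. -/
theorem Leps_apply {A : Type} [Ring A] [Algebra ℂ A] (L : Module.End ℂ A) (v : A) (x : A × A) :
    Leps L v x = (L x.1, L x.2 + x.1 * v) := by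
  simp [Leps, deform]

theorem Lameps_apply {A : Type} [Ring A] [Algebra ℂ A] (Lam φ : Module.End ℂ A) (x : A × A) :
    Lameps Lam φ x = (Lam x.1, Lam x.2 + (Lam (φ x.1) - φ (Lam x.1))) := by
  simp [Lameps, deform]

theorem Leps_pow_apply_inr {A : Type} [Ring A] [Algebra ℂ A] (L : Module.End ℂ A) (v b : A)
    (n : ℕ) : (Leps L v ^ n) (0, b) = (0, (L ^ n) b) := by
  induction n with
  | zero => rfl
  | succ n ih => simp [pow_succ', ih, Leps_apply]

theorem pow_apply_mul {A : Type} [Ring A] [Algebra ℂ A] {L : Module.End ℂ A}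
    (hL : ∀ a b : A, L (a * b) = L a * b) (a b : A) (n : ℕ) :
    (L ^ n) (a * b) = (L ^ n) a * b := by
  induction n with
  | zero => rfl
  | succ n ih => simp [pow_succ', ih, hL]

theorem Leps_pow_succ_apply_inl {A : Type} [Ring A] [Algebra ℂ A] {L : Module.End ℂ A}
    (hL : ∀ a b : A, L (a * b) = L a * b) (v a : A) (n : ℕ) :
    (Leps L v ^ (n + 1)) (a, 0) =
      ((L ^ (n + 1)) a, ((n + 1 : ℕ) : ℂ) • (L ^ n) (a * v)) := by
  induction n with
  | zero => simp [Leps_apply]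
  | succ n ih =>
    rw [pow_succ', Module.End.mul_apply, ih, Leps_apply, ← pow_apply_mul hL, map_smul,
      ← Module.End.mul_apply, ← Module.End.mul_apply, ← pow_succ', ← pow_succ',
      Nat.cast_succ (n + 1), add_smul, one_smul]

/-- **Example (Huybrechts, Ex. 1.7 ii)).** For a compatible deformation with
`L_ε = L + εv` where moreover `v ∈ P²` is primitive, the `ρ_ε`-primitive decomposition of
`Lʲ(1)` (`j ≥ 1`) is `Lʲ(1) = L_εʲ(1) + L_ε^{j−1}(−jεv)`; in particular `1` and `−jεv`
are `ρ_ε`-primitive.  Here `A[ε]` is modelled as `A × A` with `a + εb ↔ (a, b)`. -/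
theorem primitive_decomposition_of_Lj_one_deformed
    (N : ℕ) (A : Type) [Ring A] [Algebra ℂ A] [FiniteDimensional ℂ A]
    (𝒜 : ℤ → Submodule ℂ A) [GradedAlgebra 𝒜]
    (hbound : ∀ n : ℤ, (n < 0 ∨ 2 * (N : ℤ) < n) → 𝒜 n = ⊥)
    (hgc : ∀ (p q : ℤ), ∀ x ∈ 𝒜 p, ∀ y ∈ 𝒜 q, x * y = ((-1 : ℂ) ^ (p * q)) • (y * x))
    (S : CompatSL2 N A 𝒜)
    (φ : Module.End ℂ A) (v : A) (hv : v ∈ 𝒜 2)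
    (hφ0 : ∀ (n : ℤ), ∀ x ∈ 𝒜 n, φ x ∈ 𝒜 n)
    (hφL : S.L * φ - φ * S.L = LinearMap.mulRight ℂ v)
    (hvp : S.Lam v = 0)
    (j : ℕ) (hj : 1 ≤ j) :
    ((S.L ^ j) (1 : A), (0 : A)) =
        (Leps S.L v ^ j) ((1 : A), (0 : A))
        + (Leps S.L v ^ (j - 1)) ((0 : A), -((j : ℂ) • v))
      ∧ Lameps S.Lam φ ((1 : A), (0 : A)) = 0
      ∧ Lameps S.Lam φ ((0 : A), -((j : ℂ) • v)) = 0 := by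
  have Lam_zero {x : A} (hx : x ∈ 𝒜 0) : S.Lam x = 0 := by
    have h := S.Lam_deg 0 x hx
    rwa [hbound (0 - 2) (Or.inl (by norm_num)), Submodule.mem_bot] at h
  have one_mem : (1 : A) ∈ 𝒜 0 := SetLike.GradedOne.one_mem
  refine ⟨?_, ?_, ?_⟩
  · obtain ⟨n, rfl⟩ := Nat.exists_eq_add_of_le' hj
    rw [Leps_pow_succ_apply_inl S.L_mul, Nat.add_sub_cancel, Leps_pow_apply_inr]
    simp
  · simp [Lameps_apply, Lam_zero one_mem, Lam_zero (hφ0 0 1 one_mem)]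
  · simp [Lameps_apply, hvp]
end

section
/- (Infinitesimal Jordan–Lefschetz property.) Let ρ be a compatible sl₂(ℂ)-representation on A and ρ_ε a compatible infinitesimal deformation with L_ε = L + εv. Then the operators Λ and Λ_ε commute: [Λ_ε, Λ] = 0 as endomorphisms of A[ε]. Equivalently, since [Λ_ε, Λ] = ε[[Λ,φ],Λ], one has [[Λ,φ],Λ] = 0 in End(A). -/
/-- A vector of natural number weight `n` killed by `e` in a finite-dimensional representation
of an `sl₂` triple is killed by `f ^ (n + 1)`. -/
theorem IsSl2Triple.pow_toEnd_f_eq_zero {K L M : Type*} [Field K] [CharZero K] [LieRing L]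
    [LieAlgebra K L] [AddCommGroup M] [Module K M] [LieRingModule L M] [LieModule K L M]
    [FiniteDimensional K M] {h e f : L} (t : IsSl2Triple h e f) {m : M} {n : ℕ}
    (hh : ⁅h, m⁆ = (n : K) • m) (he : ⁅e, m⁆ = 0) :
    ((LieModule.toEnd K L M f) ^ (n + 1)) m = 0 := by
  by_cases hm : m = 0
  · simp [hm]
  · exact HasPrimitiveVectorWith.pow_toEnd_f_eq_zero_of_eq_nat (t := t) ⟨hm, hh, he⟩ rfl

/-- In a finite-dimensional representation of an `sl₂` triple, a vector of weight zero killed by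
`e ^ 2` is also killed by `f ^ 2`. -/
theorem IsSl2Triple.lie_f_lie_f_eq_zero (K : Type*) {L M : Type*} [Field K] [CharZero K]
    [LieRing L] [LieAlgebra K L] [AddCommGroup M] [Module K M] [LieRingModule L M]
    [LieModule K L M] [FiniteDimensional K M] {h e f : L} (t : IsSl2Triple h e f) {m : M}
    (hh : ⁅h, m⁆ = 0) (he : ⁅e, ⁅e, m⁆⁆ = 0) : ⁅f, ⁅f, m⁆⁆ = 0 := by
  have h_em : ⁅h, ⁅e, m⁆⁆ = (2 : K) • ⁅e, m⁆ := by
    rw [leibniz_lie, hh, lie_zero, add_zero, t.lie_h_e_smul K, smul_lie]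
  have h_fem : ⁅h, ⁅f, ⁅e, m⁆⁆⁆ = 0 := by
    rw [leibniz_lie, t.lie_lie_smul_f K, h_em, neg_lie, smul_lie, lie_smul, neg_add_cancel]
  have e_fem : ⁅e, ⁅f, ⁅e, m⁆⁆⁆ = (2 : K) • ⁅e, m⁆ := by
    rw [leibniz_lie, t.lie_e_f, he, lie_zero, add_zero, h_em]
  have cube : ⁅f, ⁅f, ⁅f, ⁅e, m⁆⁆⁆⁆ = 0 := by
    simpa [pow_succ] using t.pow_toEnd_f_eq_zero (K := K) (n := 2) (by simpa using h_em) he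
  have invariant : ⁅f, (2 : K) • m - ⁅f, ⁅e, m⁆⁆⁆ = 0 := by
    simpa using t.pow_toEnd_f_eq_zero (K := K) (n := 0) (m := (2 : K) • m - ⁅f, ⁅e, m⁆⁆)
      (by simp [lie_sub, hh, h_fem]) (by simp [lie_sub, e_fem])
  rw [lie_sub, lie_smul, sub_eq_zero] at invariant
  have : (2 : K) • ⁅f, ⁅f, m⁆⁆ = 0 := by rw [← lie_smul, invariant, cube]
  exact (smul_eq_zero.mp this).resolve_left two_ne_zero

namespace CompatSL2

attribute [local instance] LieRing.ofAssociativeRing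

variable {N : ℕ} {A : Type} [Ring A] [Algebra ℂ A] {𝒜 : ℤ → Submodule ℂ A}

/-- `L` and `Λ` form an `sl₂` triple with Cartan element `-B`. -/
theorem isSl2Triple (S : CompatSL2 N A 𝒜) (hB : S.B ≠ 0) : IsSl2Triple (-S.B) S.L S.Lam where
  h_ne_zero := neg_ne_zero.mpr hB
  lie_e_f := by rw [Ring.lie_def, ← S.comm_LamL, neg_sub]
  lie_h_e_nsmul := by
    rw [neg_lie, Ring.lie_def, S.comm_BL]
    exact LinearMap.ext fun x => show -((-2 : ℂ) • S.L x) = 2 • S.L x by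
      rw [neg_smul, neg_neg, two_smul, two_nsmul]
  lie_h_f_nsmul := by rw [neg_lie, Ring.lie_def, S.comm_BLam, two_smul, two_nsmul]

/-- `B` commutes with every endomorphism of degree zero. -/
theorem lie_B_eq_zero [GradedAlgebra 𝒜] (S : CompatSL2 N A 𝒜) {φ : Module.End ℂ A}
    (hφ : ∀ n, ∀ x ∈ 𝒜 n, φ x ∈ 𝒜 n) : ⁅S.B, φ⁆ = 0 := by
  rw [Ring.lie_def, sub_eq_zero]
  ext x
  induction x using DirectSum.Decomposition.inductionOn 𝒜 with
  | zero => simp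
  | homogeneous m =>
    simp only [Module.End.mul_apply]
    rw [S.B_weight _ _ (hφ _ _ m.2), S.B_weight _ _ m.2, map_zsmul]
  | add x y hx hy => rw [map_add, map_add, hx, hy]

/-- `L` commutes with right multiplications. -/
theorem lie_L_mulRight (S : CompatSL2 N A 𝒜) (v : A) :
    ⁅S.L, LinearMap.mulRight ℂ v⁆ = 0 := by
  rw [Ring.lie_def, sub_eq_zero]
  ext x
  simp [S.L_mul]

/-- A degree zero endomorphism whose commutator with `L` is a right multiplication has vanishing
double commutator with `Λ`. -/
theorem lie_Lam_lie_Lam_eq_zero [FiniteDimensional ℂ A] [GradedAlgebra 𝒜] (S : CompatSL2 N A 𝒜)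
    {φ : Module.End ℂ A} {v : A} (hφ : ∀ n, ∀ x ∈ 𝒜 n, φ x ∈ 𝒜 n)
    (hφL : ⁅S.L, φ⁆ = LinearMap.mulRight ℂ v) : ⁅S.Lam, ⁅S.Lam, φ⁆⁆ = 0 := by
  by_cases hB : S.B = 0
  · have hLam : S.Lam = 0 := by simpa [hB] using S.comm_BLam.symm
    simp [hLam]
  · refine (S.isSl2Triple hB).lie_f_lie_f_eq_zero ℂ ?_ ?_
    · rw [neg_lie, S.lie_B_eq_zero hφ, neg_zero]
    · rw [hφL, S.lie_L_mulRight]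

end CompatSL2

/-- `f + ε g` commutes with the constant extension of `f` as soon as `g` commutes with `f`. -/
theorem deform_mul_prodMap_comm {A : Type} [Ring A] [Algebra ℂ A] {f g : Module.End ℂ A}
    (hgf : g * f = f * g) : deform f g * f.prodMap f = f.prodMap f * deform f g := by
  refine LinearMap.ext fun x => Prod.ext ?_ ?_
  · simp [deform]
  · simpa [deform] using LinearMap.congr_fun hgf x.1

/-- **Theorem (Huybrechts, Thm. 2.2: infinitesimal Jordan–Lefschetz property).**
For a compatible deformation with `L_ε = L + εv`, the operators `Λ` and
`Λ_ε = Λ + ε[Λ,φ]` commute as endomorphisms of `A[ε]` (modelled as `A × A`);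
equivalently, `[[Λ,φ],Λ] = 0` in `End(A)`. -/
theorem infinitesimal_Jordan_Lefschetz
    (N : ℕ) (A : Type) [Ring A] [Algebra ℂ A] [FiniteDimensional ℂ A]
    (𝒜 : ℤ → Submodule ℂ A) [GradedAlgebra 𝒜]
    (hbound : ∀ n : ℤ, (n < 0 ∨ 2 * (N : ℤ) < n) → 𝒜 n = ⊥)
    (hgc : ∀ (p q : ℤ), ∀ x ∈ 𝒜 p, ∀ y ∈ 𝒜 q, x * y = ((-1 : ℂ) ^ (p * q)) • (y * x))
    (S : CompatSL2 N A 𝒜)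
    (φ : Module.End ℂ A) (v : A) (hv : v ∈ 𝒜 2)
    (hφ0 : ∀ (n : ℤ), ∀ x ∈ 𝒜 n, φ x ∈ 𝒜 n)
    (hφL : S.L * φ - φ * S.L = LinearMap.mulRight ℂ v)
    :
    Lameps S.Lam φ * (S.Lam.prodMap S.Lam) = (S.Lam.prodMap S.Lam) * Lameps S.Lam φ
      ∧ (S.Lam * φ - φ * S.Lam) * S.Lam = S.Lam * (S.Lam * φ - φ * S.Lam) := by
  have key : (S.Lam * φ - φ * S.Lam) * S.Lam = S.Lam * (S.Lam * φ - φ * S.Lam) :=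
    (sub_eq_zero.mp (S.lie_Lam_lie_Lam_eq_zero hφ0 hφL)).symm
  exact ⟨deform_mul_prodMap_comm key, key⟩
end

section
/- Let ρ be a compatible sl₂(ℂ)-representation on A and let φ ∈ End(A) be homogeneous of degree 0 such that [L,φ] is given by multiplication with an element v ∈ A². Then the infinitesimal deformation ρ_ε is again compatible: B_ε = B (i.e. [B,φ] = 0), L_ε and Λ_ε are homogeneous of degree 2 and −2 respectively, and L_ε(αβ) = L_ε(α)β for all α, β ∈ A[ε]. -/
/-- An endomorphism acting by scalars on each graded piece commutes with every degree `0`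
endomorphism. -/
theorem commute_of_weight_of_degree_zero {A : Type*} [Ring A] [Algebra ℂ A]
    (𝒜 : ℤ → Submodule ℂ A) [GradedAlgebra 𝒜] {B φ : Module.End ℂ A} (w : ℤ → ℤ)
    (hB : ∀ n, ∀ x ∈ 𝒜 n, B x = w n • x) (hφ : ∀ n, ∀ x ∈ 𝒜 n, φ x ∈ 𝒜 n) :
    B * φ = φ * B := by
  ext x
  induction x using DirectSum.Decomposition.inductionOn 𝒜 with
  | zero => simp
  | homogeneous m =>
    simp only [Module.End.mul_apply]
    rw [hB _ _ (hφ _ _ m.2), hB _ _ m.2, map_zsmul]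
  | add m m' hm hm' => rw [map_add, map_add, hm, hm']

/-- In a graded commutative algebra the elements of degree `2` are central. -/
theorem commute_of_mem_degree_two {A : Type*} [Ring A] [Algebra ℂ A]
    (𝒜 : ℤ → Submodule ℂ A) [GradedAlgebra 𝒜]
    (hgc : ∀ (p q : ℤ), ∀ x ∈ 𝒜 p, ∀ y ∈ 𝒜 q, x * y = ((-1 : ℂ) ^ (p * q)) • (y * x))
    {v : A} (hv : v ∈ 𝒜 2) (x : A) : x * v = v * x := by
  induction x using DirectSum.Decomposition.inductionOn 𝒜 with
  | zero => simp
  | @homogeneous p m =>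
    rw [hgc p 2 _ m.2 _ hv, (even_two.mul_left p).neg_one_zpow, one_smul]
  | add m m' hm hm' => rw [add_mul, mul_add, hm, hm']

theorem deform_apply {A : Type} [Ring A] [Algebra ℂ A] (f g : Module.End ℂ A) (x : A × A) :
    deform f g x = (f x.1, f x.2 + g x.1) := by
  simp [deform]


/-- **(Huybrechts, Sect. 1.)** If `φ` is homogeneous of degree `0` and `[L,φ]` is
multiplication by `v ∈ A²`, then the infinitesimal deformation `ρ_ε` is again compatible:
`B_ε = B` (i.e. `[B,φ] = 0`), `L_ε` and `Λ_ε` are homogeneous of degree `2` and `−2`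
on `A[ε]` (modelled as `A × A`, with degree-`n` part `𝒜 n × 𝒜 n`), and
`L_ε(xy) = L_ε(x)y` for the multiplication `(a+εb)(c+εd) = ac + ε(ad + bc)` of `A[ε]`. -/
theorem deformation_is_compatible
    (N : ℕ) (A : Type) [Ring A] [Algebra ℂ A] [FiniteDimensional ℂ A]
    (𝒜 : ℤ → Submodule ℂ A) [GradedAlgebra 𝒜]
    (hbound : ∀ n : ℤ, (n < 0 ∨ 2 * (N : ℤ) < n) → 𝒜 n = ⊥)
    (hgc : ∀ (p q : ℤ), ∀ x ∈ 𝒜 p, ∀ y ∈ 𝒜 q, x * y = ((-1 : ℂ) ^ (p * q)) • (y * x))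
    (S : CompatSL2 N A 𝒜)
    (φ : Module.End ℂ A) (v : A) (hv : v ∈ 𝒜 2)
    (hφ0 : ∀ (n : ℤ), ∀ x ∈ 𝒜 n, φ x ∈ 𝒜 n)
    (hφL : S.L * φ - φ * S.L = LinearMap.mulRight ℂ v)
    :
    S.B * φ - φ * S.B = 0
      ∧ (∀ (n : ℤ), ∀ x : A × A, x.1 ∈ 𝒜 n → x.2 ∈ 𝒜 n →
          (Leps S.L v x).1 ∈ 𝒜 (n + 2) ∧ (Leps S.L v x).2 ∈ 𝒜 (n + 2))
      ∧ (∀ (n : ℤ), ∀ x : A × A, x.1 ∈ 𝒜 n → x.2 ∈ 𝒜 n →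
          (Lameps S.Lam φ x).1 ∈ 𝒜 (n - 2) ∧ (Lameps S.Lam φ x).2 ∈ 𝒜 (n - 2))
      ∧ (∀ x y : A × A,
          Leps S.L v (x.1 * y.1, x.1 * y.2 + x.2 * y.1)
            = ((Leps S.L v x).1 * y.1,
               (Leps S.L v x).1 * y.2 + (Leps S.L v x).2 * y.1)) := by
  refine ⟨sub_eq_zero.2 (commute_of_weight_of_degree_zero 𝒜 _ S.B_weight hφ0),
    fun n x h₁ h₂ => ?_, fun n x h₁ h₂ => ?_, fun x y => ?_⟩
  · simp only [Leps, deform_apply, LinearMap.mulRight_apply]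
    exact ⟨S.L_deg n _ h₁, add_mem (S.L_deg n _ h₂) (SetLike.mul_mem_graded h₁ hv)⟩
  · simp only [Lameps, deform_apply, LinearMap.sub_apply, Module.End.mul_apply]
    exact ⟨S.Lam_deg n _ h₁, add_mem (S.Lam_deg n _ h₂)
      (sub_mem (S.Lam_deg n _ (hφ0 n _ h₁)) (hφ0 _ _ (S.Lam_deg n _ h₁)))⟩
  · simp only [Leps, deform_apply, LinearMap.mulRight_apply, map_add, S.L_mul, add_mul,
      mul_assoc, commute_of_mem_degree_two 𝒜 hgc hv y.1, add_assoc]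
end
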